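/- arXiv:2403.15964 — 2 statements merged into one kernel-verified Lean document; each statement's English description precedes it below -/
import Mathlib

section
/- Let n ≥ 2 be an integer and let H ≥ 0 and S be real numbers with S ≥ nH². Then −((n−1)/n)·( S + (n(n−2)/√(n(n−1)))·H·√(S − nH²) − n − 2nH² ) ≥ n − 1 − (√(n−1)/2)·S. -/
/-- With `m = √(n-1)`, the form `x² − ((n−2)/√(n−1))xy − y²` is bounded below by
`−(n/(2√(n−1)))(x² + y²)`. -/
theorem neg_mul_add_sq_le_sq_sub_mul_sub_sq {m : ℝ} (hm : 0 < m) (x y : ℝ) :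
    -((m ^ 2 + 1) / (2 * m)) * (x ^ 2 + y ^ 2) ≤
      x ^ 2 - (m ^ 2 - 1) / m * (x * y) - y ^ 2 := by
  rw [← sub_nonneg]
  have key : x ^ 2 - (m ^ 2 - 1) / m * (x * y) - y ^ 2 -
      -((m ^ 2 + 1) / (2 * m)) * (x ^ 2 + y ^ 2) =
      ((m + 1) * x - (m - 1) * y) ^ 2 / (2 * m) := by
    field_simp
    ring
  rw [key]
  positivity

/-- Pointwise lower bound for the right-hand side of Leung's Ricci estimate:
for `n ≥ 2`, `H ≥ 0` and `S ≥ nH²`,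
`−((n−1)/n)(S + (n(n−2)/√(n(n−1)))·H·√(S − nH²) − n − 2nH²) ≥ n − 1 − (√(n−1)/2)·S`. -/
theorem leung_bound_ge (n : ℕ) (hn : 2 ≤ n) (H S : ℝ) (hH : 0 ≤ H)
    (hS : (n : ℝ) * H ^ 2 ≤ S) :
    -(((n : ℝ) - 1) / (n : ℝ)) *
        (S + ((n : ℝ) * ((n : ℝ) - 2) / Real.sqrt ((n : ℝ) * ((n : ℝ) - 1))) * H *
            Real.sqrt (S - (n : ℝ) * H ^ 2) - (n : ℝ) - 2 * (n : ℝ) * H ^ 2) ≥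
      (n : ℝ) - 1 - Real.sqrt ((n : ℝ) - 1) / 2 * S := by
  have hn' : (2 : ℝ) ≤ n := by exact_mod_cast hn
  have hn0 : (0 : ℝ) < n := by linarith
  rw [Real.sqrt_mul hn0.le]
  have hm : 0 < Real.sqrt ((n : ℝ) - 1) := Real.sqrt_pos.2 (by linarith)
  have hr : 0 < Real.sqrt (n : ℝ) := Real.sqrt_pos.2 hn0
  have hm2 : Real.sqrt ((n : ℝ) - 1) ^ 2 = n - 1 := Real.sq_sqrt (by linarith)
  have hr2 : Real.sqrt (n : ℝ) ^ 2 = n := Real.sq_sqrt hn0.le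
  have hy2 : Real.sqrt (S - n * H ^ 2) ^ 2 = S - n * H ^ 2 := Real.sq_sqrt (by linarith)
  set m := Real.sqrt ((n : ℝ) - 1)
  set r := Real.sqrt (n : ℝ)
  set y := Real.sqrt (S - n * H ^ 2)
  have hform := neg_mul_add_sq_le_sq_sub_mul_sub_sq hm (r * H) y
  have hcoef : (n : ℝ) * (n - 2) / (r * m) = r * (m ^ 2 - 1) / m := by
    rw [hm2, div_eq_div_iff (by positivity) hm.ne', ← hr2]
    ring
  have hnm : (n : ℝ) = m ^ 2 + 1 := by linarith
  have hSxy : S = (r * H) ^ 2 + y ^ 2 := by rw [mul_pow, hr2, hy2]; ring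
  have hH2 : 2 * (n : ℝ) * H ^ 2 = 2 * (r * H) ^ 2 := by rw [mul_pow, hr2]; ring
  rw [hcoef, hH2, hSxy, hnm, ge_iff_le, ← sub_nonneg]
  have hscaled := mul_nonneg (show 0 ≤ m ^ 2 / (m ^ 2 + 1) by positivity) (sub_nonneg.2 hform)
  refine hscaled.trans_eq ?_
  field_simp
  ring
end

section
/- Let n ≥ 1 be an integer, let p ≥ 2 be a real number, let H be a real symmetric n×n matrix, and let u ∈ ℝⁿ be a unit vector. Then (trace(H) + (p−2)·⟨H u, u⟩)² ≤ n·(p−1)²·‖H‖², where ‖H‖² = Σᵢⱼ Hᵢⱼ² is the squared Frobenius norm of H. -/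
namespace Matrix

variable {m n : Type*} [Fintype m] [Fintype n]

/-- The Cauchy–Schwarz inequality for the Frobenius inner product of real matrices. -/
theorem sq_sum_sum_mul_le (A B : Matrix m n ℝ) :
    (∑ i, ∑ j, A i j * B i j) ^ 2 ≤ (∑ i, ∑ j, A i j ^ 2) * ∑ i, ∑ j, B i j ^ 2 := by
  simpa only [Fintype.sum_prod_type] using
    Finset.sum_mul_sq_le_sq_mul_sq Finset.univ (fun x : m × n => A x.1 x.2)
      (fun x : m × n => B x.1 x.2)

/-- The squared Frobenius norm of `1 + c • u uᵀ` for a unit vector `u`. -/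
theorem sum_sum_sq_one_add_smul_vecMulVec [DecidableEq n] (c : ℝ) (u : n → ℝ)
    (hu : ∑ i, u i ^ 2 = 1) :
    ∑ i, ∑ j, (1 + c • vecMulVec u u) i j ^ 2 = Fintype.card n - 1 + (1 + c) ^ 2 := by
  have entry (i j : n) : (1 + c • vecMulVec u u) i j ^ 2 =
      (if i = j then 1 + 2 * c * u i ^ 2 else 0) + c ^ 2 * (u i ^ 2 * u j ^ 2) := by
    by_cases h : i = j
    · subst h
      simp [vecMulVec_apply]
      ring
    · simp [vecMulVec_apply, h]
      ring
  simp only [entry, Finset.sum_add_distrib, Finset.sum_ite_eq, Finset.mem_univ, if_true,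
    ← Finset.mul_sum, hu, Finset.sum_const, Finset.card_univ, nsmul_eq_mul, mul_one]
  ring

/-- The Frobenius inner product of `1 + c • u uᵀ` with `A`. -/
theorem sum_sum_one_add_smul_vecMulVec_mul [DecidableEq n] (c : ℝ) (u : n → ℝ)
    (A : Matrix n n ℝ) :
    ∑ i, ∑ j, (1 + c • vecMulVec u u) i j * A i j =
      A.trace + c * ∑ i, A.mulVec u i * u i := by
  simp only [add_apply, smul_apply, vecMulVec_apply, smul_eq_mul, add_mul,
    Finset.sum_add_distrib, one_apply, ite_mul, one_mul, zero_mul, Finset.sum_ite_eq,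
    Finset.mem_univ, if_true, trace, diag_apply, mulVec, dotProduct, Finset.mul_sum,
    Finset.sum_mul]
  congr 1
  exact Finset.sum_congr rfl fun i _ => Finset.sum_congr rfl fun j _ => by ring

end Matrix

/-- For `n ≥ 1`, `p ≥ 2`, a real symmetric `n×n` matrix `H` and a unit vector `u ∈ ℝⁿ`,
`(trace H + (p−2)⟨Hu,u⟩)² ≤ n(p−1)²‖H‖²`, where `‖H‖²` is the squared Frobenius norm. -/
theorem trace_plus_quadratic_sq_le (n : ℕ) (hn : 1 ≤ n) (p : ℝ) (hp : 2 ≤ p)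
    (H : Matrix (Fin n) (Fin n) ℝ) (hH : H.IsSymm)
    (u : Fin n → ℝ) (hu : ∑ i, u i ^ 2 = 1) :
    (H.trace + (p - 2) * ∑ i, H.mulVec u i * u i) ^ 2 ≤
      (n : ℝ) * (p - 1) ^ 2 * ∑ i, ∑ j, H i j ^ 2 := by
  have hn' : (1 : ℝ) ≤ n := by exact_mod_cast hn
  have key := Matrix.sq_sum_sum_mul_le (1 + (p - 2) • Matrix.vecMulVec u u) H
  rw [Matrix.sum_sum_one_add_smul_vecMulVec_mul, Matrix.sum_sum_sq_one_add_smul_vecMulVec _ _ hu,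
    Fintype.card_fin] at key
  refine key.trans (mul_le_mul_of_nonneg_right ?_ (by positivity))
  have hp' : 1 ≤ (p - 1) ^ 2 := one_le_pow₀ (by linarith)
  nlinarith [mul_nonneg (sub_nonneg.2 hn') (sub_nonneg.2 hp')]
end
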